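/- arXiv:1302.4818 — 2 statements merged into one kernel-verified Lean document; each statement's English description precedes it below -/
import Mathlib

section
/- Let D ⊆ ℝⁿ be an open set and ϑ_k ∈ Lh₀(D) a sequence of functions locally uniformly bounded from above, and set ϑ(x) = limsup_{y→x} limsup_{k→∞} ϑ_k(y) for x ∈ D. Then the set E = {x ∈ D : limsup_{k→∞} ϑ_k(x) < ϑ(x)} is contained in a countable union of N-sets. -/
open Filter Topology

namespace QH

noncomputable section

/-- Points of `ℝⁿ`. -/
abbrev Pt (n : ℕ) := EuclideanSpace ℝ (Fin n)

/-- The Laplacian `Δu(x) = ∑ i ∂²u/∂xᵢ²(x)` of a function `u : ℝⁿ → ℝ`. -/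
def lap {n : ℕ} (u : Pt n → ℝ) (x : Pt n) : ℝ :=
  ∑ i : Fin n,
    iteratedFDeriv ℝ 2 u x ![EuclideanSpace.single i (1 : ℝ), EuclideanSpace.single i (1 : ℝ)]

/-- `u` is harmonic on the open set `D`: twice continuously differentiable with `Δu = 0` on `D`. -/
def HarmonicOn {n : ℕ} (u : Pt n → ℝ) (D : Set (Pt n)) : Prop :=
  ContDiffOn ℝ 2 u D ∧ ∀ x ∈ D, lap u x = 0

/-- The polynomial function attached to a real polynomial in `n` variables. -/
def polyFun {n : ℕ} (p : MvPolynomial (Fin n) ℝ) : Pt n → ℝ :=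
  fun x => MvPolynomial.eval (fun i => x i) p

/-- A harmonic polynomial: a real polynomial whose Laplacian vanishes identically. -/
def IsHarmonicPoly {n : ℕ} (p : MvPolynomial (Fin n) ℝ) : Prop :=
  ∀ x : Pt n, lap (polyFun p) x = 0

/-- `sup_K |g|`. -/
def supAbs {n : ℕ} (g : Pt n → ℝ) (K : Set (Pt n)) : ℝ :=
  sSup ((fun x => |g x|) '' K)

/-- `l_m(f,K)`: least deviation of `f` on `K` from harmonic polynomials of degree `≤ m`. -/
def bestApprox {n : ℕ} (f : Pt n → ℝ) (K : Set (Pt n)) (m : ℕ) : ℝ :=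
  sInf {t : ℝ | ∃ p : MvPolynomial (Fin n) ℝ,
    IsHarmonicPoly p ∧ p.totalDegree ≤ m ∧ t = supAbs (fun x => f x - polyFun p x) K}

/-- The class `qh(K)` of quasiharmonic functions on a compact `K`. -/
def QuasiHarmonic {n : ℕ} (f : Pt n → ℝ) (K : Set (Pt n)) : Prop :=
  ContinuousOn f K ∧
    Filter.liminf (fun m : ℕ => (bestApprox f K m) ^ ((m : ℝ)⁻¹)) Filter.atTop < 1

/-- `E` is `H`-regular at `x₀`. -/
def HRegularAt {n : ℕ} (E : Set (Pt n)) (x₀ : Pt n) : Prop :=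
  ∀ b : ℝ, 1 < b → ∃ M > (0 : ℝ), ∃ r > (0 : ℝ),
    ∀ p : MvPolynomial (Fin n) ℝ, IsHarmonicPoly p →
      supAbs (polyFun p) (Metric.ball x₀ r) ≤
        M * b ^ p.totalDegree * supAbs (polyFun p) (E ∩ Metric.ball x₀ r)

/-- `E` is `H`-regular: `H`-regular at each of its points. -/
def HRegular {n : ℕ} (E : Set (Pt n)) : Prop :=
  ∀ x ∈ E, HRegularAt E x

/-- `ln |t|` with values in `[-∞, ∞)`, equal to `-∞` at `t = 0`. -/
def elnAbs (t : ℝ) : EReal :=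
  if t = 0 then ⊥ else ((Real.log |t| : ℝ) : EReal)

/-- The class `Lh_ε(D)`: the minimal class of `[-∞,∞)`-valued functions containing all
`α·ln|u|` with `u` harmonic on `D`, `0 < α < ε`, and closed under upper regularization of
suprema of families of its members. -/
inductive LhEps {n : ℕ} (D : Set (Pt n)) (ε : ℝ) : (Pt n → EReal) → Prop
  | base (α : ℝ) (u : Pt n → ℝ) (h0 : 0 < α) (hε : α < ε) (hu : HarmonicOn u D) :
      LhEps D ε (fun x => (α : EReal) * elnAbs (u x))
  | reg (S : Set (Pt n → EReal)) (hS : ∀ v ∈ S, LhEps D ε v) :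
      LhEps D ε (fun x => Filter.limsup (fun y => ⨆ v ∈ S, v y) (𝓝[D] x))

/-- The class `Lh₀(D) = ⋃_{ε>0} Lh_ε(D)`. -/
def Lh0 {n : ℕ} (D : Set (Pt n)) (f : Pt n → EReal) : Prop :=
  ∃ ε > (0 : ℝ), LhEps D ε f

/-- A sequence of functions is locally uniformly bounded from above on `D`. -/
def LocUnifBddAbove {n : ℕ} (D : Set (Pt n)) (ϑ : ℕ → Pt n → EReal) : Prop :=
  ∀ x ∈ D, ∃ U ∈ 𝓝 x, ∃ C : ℝ, ∀ k : ℕ, ∀ y ∈ U ∩ D, ϑ k y ≤ (C : EReal)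

/-- `E ⊆ ℝⁿ` is an `N`-set. -/
def IsNSet {n : ℕ} (E : Set (Pt n)) : Prop :=
  ∃ D : Set (Pt n), IsOpen D ∧ E ⊆ D ∧
    ∃ ϑ : ℕ → Pt n → EReal,
      (∀ k, Lh0 D (ϑ k)) ∧
      (∀ k x, ϑ k x ≤ ϑ (k + 1) x) ∧
      LocUnifBddAbove D ϑ ∧
      E ⊆ {x ∈ D | Filter.limsup (fun k => ϑ k x) Filter.atTop <
            Filter.limsup (fun y => Filter.limsup (fun k => ϑ k y) Filter.atTop) (𝓝[D] x)}

/-- Zahariuta's extremal function `χ_ε(x, E, D)`. -/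
def chiEps {n : ℕ} (E D : Set (Pt n)) (ε : ℝ) (x : Pt n) : EReal :=
  Filter.limsup (fun y => sSup {t : EReal |
    ∃ α : ℝ, ∃ u : Pt n → ℝ, 0 < α ∧ α < ε ∧ HarmonicOn u D ∧
      (∀ z ∈ E, |u z| ≤ 1) ∧
      (⨆ z ∈ D, ENNReal.ofReal |u z|) ^ α ≤ ENNReal.ofReal (Real.exp 1) ∧
      t = (α : EReal) * elnAbs (u y)}) (𝓝[D] x)

/-- The `χ₀`-measure of `E` relative to `D`: the limit of `χ_ε` as `ε → 0⁺`, which (by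
monotonicity of `χ_ε` in `ε`) equals the infimum over `ε > 0`. -/
def chi0 {n : ℕ} (E D : Set (Pt n)) (x : Pt n) : EReal :=
  ⨅ (ε : ℝ) (_ : 0 < ε), chiEps E D ε x

/-- `E` is `Lh₀`-polar relative to `D`. -/
def Lh0Polar {n : ℕ} (E D : Set (Pt n)) : Prop :=
  ∃ ϑ : Pt n → EReal, Lh0 D ϑ ∧ (∃ x ∈ D, ϑ x ≠ ⊥) ∧ ∀ x ∈ E, ϑ x = ⊥


lemma LhEps.mono {n : ℕ} {D : Set (Pt n)} {ε δ : ℝ} (hεδ : ε ≤ δ) {f : Pt n → EReal}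
    (hf : LhEps D ε f) : LhEps D δ f := by
  induction hf with
  | base α u h0 hα hu => exact .base α u h0 (hα.trans_le hεδ) hu
  | reg S _ ih => exact .reg S ih

lemma elnAbs_eq_log (t : ℝ) : elnAbs t = ENNReal.log (ENNReal.ofReal |t|) := by
  unfold elnAbs
  split_ifs with h
  · simp [h]
  · rw [ENNReal.log_ofReal_of_pos (abs_pos.mpr h)]

lemma continuous_elnAbs : Continuous elnAbs := by
  rw [funext elnAbs_eq_log]
  exact ENNReal.continuous_log.comp (ENNReal.continuous_ofReal.comp continuous_abs)

/-- The upper regularization relative to `D` of any function is upper semicontinuous on `D`. -/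
lemma upperSemicontinuousOn_limsup_nhdsWithin {X : Type*} [TopologicalSpace X] (D : Set X)
    (g : X → EReal) : UpperSemicontinuousOn (fun x => limsup g (𝓝[D] x)) D := by
  intro x _ c hc
  obtain ⟨b, hb, hbc⟩ := exists_between hc
  filter_upwards [eventually_eventually_nhdsWithin.mpr (eventually_lt_of_limsup_lt hb)] with y hy
  exact (limsup_le_of_le (h := hy.mono fun _ h => h.le)).trans_lt hbc

/-- Functions of the class `Lh_ε(D)` are upper semicontinuous on `D`. -/
lemma LhEps.upperSemicontinuousOn {n : ℕ} {D : Set (Pt n)} {ε : ℝ} {f : Pt n → EReal}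
    (hf : LhEps D ε f) : UpperSemicontinuousOn f D := by
  cases hf with
  | base α u h0 hα hu =>
    have h : Continuous fun t : ℝ => (α : EReal) * elnAbs t := by
      have hα0 : (α : EReal) ≠ 0 := EReal.coe_ne_zero.mpr h0.ne'
      refine continuous_iff_continuousAt.mpr fun t => ?_
      exact (EReal.continuousAt_mul (p := ((α : EReal), elnAbs t)) (.inl hα0) (.inl hα0)
        (.inl (EReal.coe_ne_bot α)) (.inl (EReal.coe_ne_top α))).comp
        (f := fun t => ((α : EReal), elnAbs t))
        (continuousAt_const.prodMk continuous_elnAbs.continuousAt)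
    exact (h.comp_continuousOn hu.1.continuousOn).upperSemicontinuousOn
  | reg S hS => exact upperSemicontinuousOn_limsup_nhdsWithin D _

/-- The upper regularization on `D` of the maximum of `ϑ k, …, ϑ (k + l)`. -/
def regMax {n : ℕ} (D : Set (Pt n)) (ϑ : ℕ → Pt n → EReal) (k l : ℕ) (x : Pt n) : EReal :=
  limsup (fun y => ⨆ v ∈ ϑ '' Set.Icc k (k + l), v y) (𝓝[D] x)

section regMax

variable {n : ℕ} {D : Set (Pt n)} {ϑ : ℕ → Pt n → EReal}

lemma regMax_mem_Lh0 (hLh : ∀ k, Lh0 D (ϑ k)) (k l : ℕ) : Lh0 D (regMax D ϑ k l) := by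
  choose ε hε hϑ using hLh
  obtain ⟨δ, hδ⟩ := ((Set.finite_Icc k (k + l)).image ε).bddAbove
  refine ⟨δ, (hε k).trans_le (hδ (Set.mem_image_of_mem ε (by simp))), .reg _ ?_⟩
  rintro _ ⟨j, hj, rfl⟩
  exact (hϑ j).mono (hδ (Set.mem_image_of_mem ε hj))

lemma regMax_le_succ (k l : ℕ) (x : Pt n) : regMax D ϑ k l x ≤ regMax D ϑ k (l + 1) x :=
  limsup_le_limsup (.of_forall fun _ =>
    biSup_mono (Set.image_mono (Set.Icc_subset_Icc_right (by omega))))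

lemma le_regMax {k l j : ℕ} (hkj : k ≤ j) (hjl : j ≤ k + l) {x : Pt n} (hx : x ∈ D) :
    ϑ j x ≤ regMax D ϑ k l x := by
  refine le_limsup_of_le (h := fun b hb => ?_)
  have hj : ϑ j ∈ ϑ '' Set.Icc k (k + l) := ⟨j, ⟨hkj, hjl⟩, rfl⟩
  exact (le_biSup (fun v : Pt n → EReal => v x) hj).trans
    (hb.self_of_nhdsWithin hx)

lemma regMax_le (hLh : ∀ k, Lh0 D (ϑ k)) {k l : ℕ} {x : Pt n} (hx : x ∈ D) {c : EReal}
    (hc : ∀ j, k ≤ j → ϑ j x ≤ c) : regMax D ϑ k l x ≤ c := by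
  refine le_of_forall_gt_imp_ge_of_dense fun b hb => limsup_le_of_le (h := ?_)
  have h : ∀ j ∈ Set.Icc k (k + l), ∀ᶠ y in 𝓝[D] x, ϑ j y < b := fun j hj =>
    (hLh j).choose_spec.2.upperSemicontinuousOn x hx b ((hc j hj.1).trans_lt hb)
  filter_upwards [(Set.finite_Icc k (k + l)).eventually_all.mpr h] with y hy
  refine iSup₂_le ?_
  rintro _ ⟨j, hj, rfl⟩
  exact (hy j hj).le

end regMax

/-- **Proposition 1.** If `ϑ_k ∈ Lh₀(D)` is a sequence locally uniformly bounded from above and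
`ϑ(x) = limsup_{y→x} limsup_k ϑ_k(y)`, then `{x ∈ D : limsup_k ϑ_k(x) < ϑ(x)}` is contained in
a countable union of `N`-sets. -/
theorem countable_union_of_NSets {n : ℕ} (D : Set (Pt n)) (hD : IsOpen D)
    (ϑ : ℕ → Pt n → EReal) (hLh : ∀ k, Lh0 D (ϑ k)) (hbdd : LocUnifBddAbove D ϑ) :
    ∃ F : ℕ → Set (Pt n), (∀ i, IsNSet (F i)) ∧
      {x ∈ D | Filter.limsup (fun k => ϑ k x) Filter.atTop <
        Filter.limsup (fun y => Filter.limsup (fun k => ϑ k y) Filter.atTop) (𝓝[D] x)} ⊆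
        ⋃ i, F i := by
  refine ⟨fun k => {x ∈ D | limsup (fun l => regMax D ϑ k l x) atTop <
    limsup (fun y => limsup (fun l => regMax D ϑ k l y) atTop) (𝓝[D] x)}, fun k => ?_, ?_⟩
  · refine ⟨D, hD, Set.sep_subset _ _, regMax D ϑ k, regMax_mem_Lh0 hLh k, regMax_le_succ k,
      fun x hx => ?_, subset_rfl⟩
    obtain ⟨U, hU, C, hC⟩ := hbdd x hx
    exact ⟨U, hU, C, fun l y hy => regMax_le hLh hy.2 fun j _ => hC j y hy⟩
  · rintro x ⟨hx, hlt⟩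
    obtain ⟨b, hb, hbϑ⟩ := exists_between hlt
    obtain ⟨k, hk⟩ := eventually_atTop.mp (eventually_lt_of_limsup_lt hb)
    refine Set.mem_iUnion.mpr ⟨k, hx, lt_of_le_of_lt ?_ (hbϑ.trans_le ?_)⟩
    · exact limsup_le_of_le (h := .of_forall fun l =>
        regMax_le hLh hx fun j hj => (hk j hj).le)
    · refine limsup_le_limsup ?_
      filter_upwards [self_mem_nhdsWithin] with y hy
      rw [← limsup_nat_add (fun j => ϑ j y) k]
      exact limsup_le_limsup (.of_forall fun l => le_regMax (by omega) (by omega) hy)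

end

end QH
end

section
/- Let D ⊆ ℝⁿ be an open set and ϑ_k : D → [−∞,∞) a sequence of functions that is locally uniformly bounded from above. For l ∈ ℕ set S_l(x) = sup_{k≥l} ϑ_k(x) and S_l*(x) = limsup_{y→x} S_l(y). Then {x ∈ D : limsup_{k→∞} ϑ_k(x) < limsup_{y→x} limsup_{k→∞} ϑ_k(y)} ⊆ ⋃_{l=1}^∞ {x ∈ D : S_l(x) < S_l*(x)}. -/
open Filter Topology

namespace QH

noncomputable section

/-- For a sequence `ϑ_k : D → [-∞,∞)` locally uniformly bounded from above, with
`S_l(x) = sup_{k ≥ l} ϑ_k(x)` and `S_l*(x) = limsup_{y→x} S_l(y)`, the set where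
`limsup_k ϑ_k(x) < limsup_{y→x} limsup_k ϑ_k(y)` is contained in `⋃_{l≥1} {S_l < S_l*}`. -/
theorem subset_union_defect_sets {n : ℕ} (D : Set (Pt n)) (hD : IsOpen D)
    (ϑ : ℕ → Pt n → EReal) (hbdd : LocUnifBddAbove D ϑ) :
    {x ∈ D | Filter.limsup (fun k => ϑ k x) Filter.atTop <
      Filter.limsup (fun y => Filter.limsup (fun k => ϑ k y) Filter.atTop) (𝓝[D] x)} ⊆
    ⋃ (l : ℕ) (_ : 1 ≤ l),
      {x ∈ D | (⨆ (k : ℕ) (_ : l ≤ k), ϑ k x) <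
        Filter.limsup (fun y => ⨆ (k : ℕ) (_ : l ≤ k), ϑ k y) (𝓝[D] x)} := by
  rintro x ⟨hx, hlt⟩
  rw [limsup_eq_iInf_iSup_of_nat (u := fun k => ϑ k x)] at hlt
  obtain ⟨l, hl⟩ := iInf_lt_iff.1 hlt
  refine Set.mem_iUnion₂.2 ⟨max l 1, le_max_right l 1, hx, ?_⟩
  refine (biSup_mono fun k hk => (le_max_left l 1).trans hk).trans_lt
    (hl.trans_le (limsup_le_limsup (Eventually.of_forall fun y => ?_)))
  dsimp only
  rw [limsup_eq_iInf_iSup_of_nat (u := fun k => ϑ k y)]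
  exact iInf_le _ (max l 1)

end

end QH
end
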